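/- arXiv:1901.05960 — 10 statements merged into one kernel-verified Lean document; each statement's English description precedes it below -/
import Mathlib

section
/- Let b, c be real numbers. There exists a real number α satisfying −27α² + 2c(9b − 2c²)α + b²(c² − 4b) = 0 if and only if c² ≥ 3b. In other words, the discriminant Δ₃(α) of the cubic αx³ + bx² + cx + 1 can vanish for a real value of the leading coefficient α if and only if c² ≥ 3b. -/
/-- There is a real `α` with `−27α² + 2c(9b − 2c²)α + b²(c² − 4b) = 0` iff `c² ≥ 3b`. -/
theorem stmt3 (b c : ℝ) :
    (∃ α : ℝ, -27 * α ^ 2 + 2 * c * (9 * b - 2 * c ^ 2) * α + b ^ 2 * (c ^ 2 - 4 * b) = 0) ↔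
      c ^ 2 ≥ 3 * b := by
  constructor
  · rintro ⟨α, h⟩
    have h1 : (27 * α - c * (9 * b - 2 * c ^ 2)) ^ 2 = 4 * (c ^ 2 - 3 * b) ^ 3 := by
      linear_combination (-27) * h
    by_contra hlt
    have h2 : 0 < 3 * b - c ^ 2 := by linarith [not_le.mp hlt]
    have h3 : 0 < (3 * b - c ^ 2) ^ 3 := pow_pos h2 3
    have h4 := sq_nonneg (27 * α - c * (9 * b - 2 * c ^ 2))
    have h5 : (c ^ 2 - 3 * b) ^ 3 = -(3 * b - c ^ 2) ^ 3 := by ring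
    rw [h1, h5] at h4
    linarith
  · intro h
    obtain ⟨s, hs⟩ : ∃ s : ℝ, s ^ 2 = c ^ 2 - 3 * b :=
      ⟨Real.sqrt (c ^ 2 - 3 * b), Real.sq_sqrt (by linarith)⟩
    refine ⟨(c * (9 * b - 2 * c ^ 2) + 2 * s ^ 3) / 27, ?_⟩
    have hb : b = (c ^ 2 - s ^ 2) / 3 := by linarith
    subst hb
    ring
end

section
/- Let b, c be real numbers with b ≠ 0 and c² > 4b, and set s = √(c² − 3b), α₊ = −(2/27)c³ + (1/3)bc + (2/27)s³ and α₋ = −(2/27)c³ + (1/3)bc − (2/27)s³. Then the two roots of the equation −27α² + 2c(9b − 2c²)α + b²(c² − 4b) = 0 have opposite signs: α₊ > 0 and α₋ < 0. -/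
/-- If `b ≠ 0` and `c² > 4b`, the two roots `α₊, α₋` of
`−27α² + 2c(9b − 2c²)α + b²(c² − 4b) = 0` have opposite signs: `α₊ > 0` and `α₋ < 0`. -/
theorem stmt4 (b c : ℝ) (hb : b ≠ 0) (h : c ^ 2 > 4 * b) (s : ℝ)
    (hs : s = Real.sqrt (c ^ 2 - 3 * b)) :
    -(2 / 27) * c ^ 3 + (1 / 3) * b * c + (2 / 27) * s ^ 3 > 0 ∧
    -(2 / 27) * c ^ 3 + (1 / 3) * b * c - (2 / 27) * s ^ 3 < 0 := by
  have hnn : 0 ≤ c ^ 2 - 3 * b := by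
    rcases le_total b 0 with h0 | h0 <;> nlinarith [sq_nonneg c]
  have hs0 : 0 ≤ s := hs ▸ Real.sqrt_nonneg _
  have hs2 : s ^ 2 = c ^ 2 - 3 * b := by rw [hs, Real.sq_sqrt hnn]
  have hpos : 0 < b ^ 2 * (c ^ 2 - 4 * b) := mul_pos (by positivity) (by linarith)
  have hB : 0 ≤ (2 / 27) * s ^ 3 := by positivity
  have h6 : ((2 / 27) * s ^ 3) ^ 2 = (4 / 729) * (c ^ 2 - 3 * b) ^ 3 := by
    rw [← hs2]; ring
  have hlt : (-(2 / 27) * c ^ 3 + (1 / 3) * b * c) ^ 2 < ((2 / 27) * s ^ 3) ^ 2 := by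
    rw [h6]; linarith
  have := abs_lt.mp (abs_lt_of_sq_lt_sq hlt hB)
  constructor <;> linarith [this.1, this.2]
end

section
/- Let a > 0 and c < 0 be real numbers with a > −4c³/27. Then the depressed cubic equation ax³ + cx + 1 = 0 has exactly one real root x₀, and it satisfies x₀ < −(1/a)^{1/3}. -/
/-- For `a > 0`, `c < 0` with `a > −4c³/27`, the equation `ax³ + cx + 1 = 0` has exactly one
real root `x₀`, and `x₀ < −(1/a)^{1/3}`. -/
theorem stmt10 (a c : ℝ) (ha : 0 < a) (hc : c < 0) (h : a > -4 * c ^ 3 / 27) :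
    ∃ x₀ : ℝ, a * x₀ ^ 3 + c * x₀ + 1 = 0 ∧
      x₀ < -(1 / a) ^ ((1 : ℝ) / 3) ∧
      ∀ y : ℝ, a * y ^ 3 + c * y + 1 = 0 → y = x₀ := by
  have hneg : ∀ y : ℝ, a * y ^ 3 + c * y + 1 = 0 → y < 0 := by
    intro y hy
    by_contra hn
    have hy0 : 0 < y := by
      rcases (not_lt.mp hn).lt_or_eq with h1 | h1
      · exact h1
      · rw [← h1] at hy
        norm_num at hy
    have hy3 : 0 < y ^ 3 := by positivity
    have ht : 0 < a * y ^ 3 := by positivity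
    have e : (a * y ^ 3 + 1) ^ 3 = -c ^ 3 * y ^ 3 := by
      have : a * y ^ 3 + 1 = -c * y := by linarith
      rw [this]; ring
    have h2 : 0 ≤ (a * y ^ 3 - 1 / 2) ^ 2 * (a * y ^ 3 + 4) := by positivity
    have h3 : 0 < (a - -4 * c ^ 3 / 27) * y ^ 3 := mul_pos (by linarith) hy3
    nlinarith
  obtain ⟨r, hr⟩ : ∃ r, r = (1 / a) ^ ((1 : ℝ) / 3) := ⟨_, rfl⟩
  have hr0 : 0 < r := by rw [hr]; positivity
  have hr3 : a * r ^ 3 = 1 := by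
    have : r ^ 3 = 1 / a := by
      rw [hr, ← Real.rpow_natCast, ← Real.rpow_mul (by positivity)]
      norm_num
    rw [this]; field_simp
  rw [← hr]
  obtain ⟨M, hM⟩ : ∃ M, M = r + 1 + (1 - c) / a := ⟨_, rfl⟩
  have hq : 0 < (1 - c) / a := div_pos (by linarith) ha
  have haM : 1 - c < a * M := by
    have : a * M = a * r + a + (1 - c) := by rw [hM]; field_simp
    have : 0 < a * r := by positivity
    linarith
  have hM1 : 1 < M := by linarith
  have hcont : ContinuousOn (fun x : ℝ => a * x ^ 3 + c * x + 1) (Set.Icc (-M) (-r)) := by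
    fun_prop
  have hivt := intermediate_value_Ioo (by linarith : -M ≤ -r) hcont
  have hmem : (0 : ℝ) ∈ Set.Ioo (a * (-M) ^ 3 + c * (-M) + 1) (a * (-r) ^ 3 + c * (-r) + 1) := by
    constructor
    · have h1 : 1 - c < a * M * M := by nlinarith
      nlinarith [mul_pos (sub_pos.mpr h1) (by linarith : 0 < M)]
    · nlinarith [mul_pos hr0 (neg_pos.mpr hc)]
  obtain ⟨x, hx, hx0⟩ := hivt hmem
  simp only at hx0
  refine ⟨x, hx0, hx.2, fun y hy => ?_⟩
  by_contra hne
  have hxn := hneg x hx0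
  have hyn := hneg y hy
  have h1 : a * (x ^ 2 + x * y + y ^ 2) + c = 0 := by
    apply mul_left_cancel₀ (sub_ne_zero.mpr hne)
    linear_combination hy - hx0
  have h2 : a * (x * y) * (x + y) = 1 := by
    linear_combination x * h1 - hx0
  have h3 : 0 < a * (x * y) := mul_pos ha (mul_pos_of_neg_of_neg hxn hyn)
  nlinarith
end

section
/- Let a > 0 and c < 0 be real numbers with a < −4c³/27. Then the depressed cubic equation ax³ + cx + 1 = 0 has exactly three real roots x₁ < x₂ < x₃, and they satisfy x₁ < −(1/a)^{1/3}, 0 < x₂ < −3/(2c), and x₃ > −3/(2c). -/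
/-- For `a > 0`, `c < 0` with `a < −4c³/27`, the equation `ax³ + cx + 1 = 0` has exactly three
real roots `x₁ < x₂ < x₃`, with `x₁ < −(1/a)^{1/3}`, `0 < x₂ < −3/(2c)` and `x₃ > −3/(2c)`. -/
theorem stmt11 (a c : ℝ) (ha : 0 < a) (hc : c < 0) (h : a < -4 * c ^ 3 / 27) :
    ∃ x₁ x₂ x₃ : ℝ, x₁ < x₂ ∧ x₂ < x₃ ∧
      a * x₁ ^ 3 + c * x₁ + 1 = 0 ∧
      a * x₂ ^ 3 + c * x₂ + 1 = 0 ∧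
      a * x₃ ^ 3 + c * x₃ + 1 = 0 ∧
      (∀ y : ℝ, a * y ^ 3 + c * y + 1 = 0 → y = x₁ ∨ y = x₂ ∨ y = x₃) ∧
      x₁ < -(1 / a) ^ ((1 : ℝ) / 3) ∧
      0 < x₂ ∧ x₂ < -3 / (2 * c) ∧
      -3 / (2 * c) < x₃ := by
  obtain ⟨t, ht⟩ : ∃ t : ℝ, t = (1 / a) ^ ((1 : ℝ) / 3) := ⟨_, rfl⟩
  obtain ⟨k, hk⟩ : ∃ k : ℝ, k = -3 / (2 * c) := ⟨_, rfl⟩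
  rw [← ht, ← hk]
  have ht0 : 0 < t := by rw [ht]; positivity
  have ht3 : a * t ^ 3 = 1 := by
    have : t ^ 3 = 1 / a := by
      rw [ht, ← Real.rpow_natCast, ← Real.rpow_mul (by positivity)]
      norm_num
    rw [this]; field_simp
  have hk0 : 0 < k := by
    rw [hk]; exact div_pos_of_neg_of_neg (by norm_num) (by linarith)
  have hck : c * k = -3 / 2 := by
    have := hc.ne
    rw [hk]; field_simp
  have hfk : a * k ^ 3 + c * k + 1 < 0 := by
    have h1 : a * k ^ 3 < -4 * c ^ 3 / 27 * k ^ 3 :=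
      mul_lt_mul_of_pos_right h (by positivity)
    have h2 : -4 * c ^ 3 / 27 * k ^ 3 = -4 / 27 * (c * k) ^ 3 := by ring
    rw [h2, hck] at h1
    rw [hck]; linarith
  obtain ⟨M, hM⟩ : ∃ M : ℝ, M = 1 + (1 - c) / a + t + k := ⟨_, rfl⟩
  have hd : 0 < (1 - c) / a := div_pos (by linarith) ha
  have hM1 : 1 < M := by linarith
  have haM : 1 - c < a * M := by
    have : a * ((1 - c) / a) = 1 - c := by field_simp
    have h3 : a * M = a * ((1 - c) / a) + a * (1 + t + k) := by rw [hM]; ring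
    have : 0 < a * (1 + t + k) := by positivity
    linarith
  have haM3 : (1 - c) * M < a * M ^ 3 := by
    have h1 : (1 - c) * M < a * M * M := mul_lt_mul_of_pos_right haM (by linarith)
    have h2 : a * M * M * 1 < a * M * M * M :=
      mul_lt_mul_of_pos_left hM1 (by positivity)
    nlinarith
  have hcont : Continuous (fun x : ℝ => a * x ^ 3 + c * x + 1) := by fun_prop
  obtain ⟨x₁, ⟨_, h1b⟩, h1⟩ := intermediate_value_Ioo (show -M ≤ -t by linarith)
    hcont.continuousOn (show (0 : ℝ) ∈ Set.Ioo _ _ from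
      ⟨by nlinarith, by nlinarith [mul_pos (neg_pos.2 hc) ht0]⟩)
  obtain ⟨x₂, ⟨h2a, h2b⟩, h2⟩ := intermediate_value_Ioo' hk0.le
    hcont.continuousOn (show (0 : ℝ) ∈ Set.Ioo _ _ from ⟨hfk, by norm_num⟩)
  obtain ⟨x₃, ⟨h3a, _⟩, h3⟩ := intermediate_value_Ioo (show k ≤ M by linarith)
    hcont.continuousOn (show (0 : ℝ) ∈ Set.Ioo _ _ from ⟨hfk, by nlinarith⟩)
  simp only at h1 h2 h3
  refine ⟨x₁, x₂, x₃, by linarith, by linarith, h1, h2, h3, ?_, h1b, h2a, h2b, h3a⟩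
  have key : ∀ u v w : ℝ, a * u ^ 3 + c * u + 1 = 0 → a * v ^ 3 + c * v + 1 = 0 →
      a * w ^ 3 + c * w + 1 = 0 → u ≠ v → u ≠ w → v ≠ w → u + v + w = 0 := by
    intro u v w hu hv hw huv huw hvw
    have e1 : a * (u ^ 2 + u * v + v ^ 2) + c = 0 :=
      mul_left_cancel₀ (sub_ne_zero.2 huv) (by linear_combination hu - hv)
    have e2 : a * (u ^ 2 + u * w + w ^ 2) + c = 0 :=
      mul_left_cancel₀ (sub_ne_zero.2 huw) (by linear_combination hu - hw)
    exact mul_left_cancel₀ (mul_ne_zero ha.ne' (sub_ne_zero.2 hvw))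
      (by linear_combination e1 - e2)
  intro y hy
  by_contra! hne
  obtain ⟨n1, n2, n3⟩ := hne
  have s1 := key x₁ x₂ x₃ h1 h2 h3 (by linarith : x₁ < x₂).ne (by linarith : x₁ < x₃).ne
    (by linarith : x₂ < x₃).ne
  have s2 := key y x₁ x₂ hy h1 h2 n1 n2 (by linarith : x₁ < x₂).ne
  exact n3 (by linarith)
end

section
/- Let a < 0 and c < 0 be real numbers. Then the depressed cubic equation ax³ + cx + 1 = 0 has exactly one real root x₀, and it satisfies 0 < x₀ < (−1/a)^{1/3}. -/
/-- For `a < 0`, `c < 0`, the equation `ax³ + cx + 1 = 0` has exactly one real root `x₀`, and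
`0 < x₀ < (−1/a)^{1/3}`. -/
theorem stmt12 (a c : ℝ) (ha : a < 0) (hc : c < 0) :
    ∃ x₀ : ℝ, a * x₀ ^ 3 + c * x₀ + 1 = 0 ∧
      0 < x₀ ∧ x₀ < (-1 / a) ^ ((1 : ℝ) / 3) ∧
      ∀ y : ℝ, a * y ^ 3 + c * y + 1 = 0 → y = x₀ := by
  have hpos : 0 < -1 / a := div_pos_of_neg_of_neg (by norm_num) ha
  have hr3 : ((-1 / a) ^ ((1 : ℝ) / 3)) ^ 3 = -1 / a := by
    rw [← Real.rpow_natCast, ← Real.rpow_mul hpos.le]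
    norm_num
  have hr : 0 < (-1 / a) ^ ((1 : ℝ) / 3) := Real.rpow_pos_of_pos hpos _
  generalize (-1 / a) ^ ((1 : ℝ) / 3) = r at hr3 hr
  have har : a * r ^ 3 = -1 := by
    rw [hr3]
    have hne := ha.ne
    field_simp
  have hcr : c * r < 0 := mul_neg_of_neg_of_pos hc hr
  have hcont : ContinuousOn (fun x : ℝ => a * x ^ 3 + c * x + 1) (Set.Icc 0 r) := by
    fun_prop
  obtain ⟨x, ⟨hx0, hxr⟩, hx⟩ := intermediate_value_Ioo' hr.le hcont
    (show (0 : ℝ) ∈ Set.Ioo (a * r ^ 3 + c * r + 1) (a * 0 ^ 3 + c * 0 + 1) from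
      ⟨by linarith, by norm_num⟩)
  have hx' : a * x ^ 3 + c * x + 1 = 0 := hx
  refine ⟨x, hx', hx0, hxr, fun y hy => ?_⟩
  have h : (y - x) * (a * (y ^ 2 + x * y + x ^ 2) + c) = 0 := by
    linear_combination hy - hx'
  have hq : 0 ≤ y ^ 2 + x * y + x ^ 2 := by
    nlinarith [sq_nonneg (x + y), sq_nonneg x, sq_nonneg y]
  have hneg : a * (y ^ 2 + x * y + x ^ 2) + c < 0 := by
    have := mul_nonpos_of_nonpos_of_nonneg ha.le hq
    linarith
  rcases mul_eq_zero.mp h with h | h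
  · linarith
  · exact absurd h hneg.ne
end

section
/- Let a < 0 and c > 0 be real numbers with −4c³/27 < a < 0. Then the depressed cubic equation ax³ + cx + 1 = 0 has exactly three real roots x₁ < x₂ < x₃, and they satisfy x₁ < −3/(2c), −3/(2c) < x₂ < 0, and x₃ > (−1/a)^{1/3}. -/
/-- For `a < 0`, `c > 0` with `−4c³/27 < a < 0`, the equation `ax³ + cx + 1 = 0` has exactly
three real roots `x₁ < x₂ < x₃`, with `x₁ < −3/(2c)`, `−3/(2c) < x₂ < 0` and
`x₃ > (−1/a)^{1/3}`. -/
theorem stmt13 (a c : ℝ) (ha : a < 0) (hc : 0 < c) (h : -4 * c ^ 3 / 27 < a) :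
    ∃ x₁ x₂ x₃ : ℝ, x₁ < x₂ ∧ x₂ < x₃ ∧
      a * x₁ ^ 3 + c * x₁ + 1 = 0 ∧
      a * x₂ ^ 3 + c * x₂ + 1 = 0 ∧
      a * x₃ ^ 3 + c * x₃ + 1 = 0 ∧
      (∀ y : ℝ, a * y ^ 3 + c * y + 1 = 0 → y = x₁ ∨ y = x₂ ∨ y = x₃) ∧
      x₁ < -3 / (2 * c) ∧
      -3 / (2 * c) < x₂ ∧ x₂ < 0 ∧
      (-1 / a) ^ ((1 : ℝ) / 3) < x₃ := by
  obtain ⟨r, hr⟩ : ∃ r : ℝ, r = (-1 / a) ^ ((1 : ℝ) / 3) := ⟨_, rfl⟩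
  obtain ⟨t, ht⟩ : ∃ t : ℝ, t = -3 / (2 * c) := ⟨_, rfl⟩
  rw [← hr, ← ht]
  have hane : a ≠ 0 := ha.ne
  have hpos : 0 < -1 / a := div_pos_of_neg_of_neg (by norm_num) ha
  have hr0 : 0 < r := by rw [hr]; exact Real.rpow_pos_of_pos hpos _
  have hr3 : a * r ^ 3 = -1 := by
    have h3 : r ^ 3 = -1 / a := by
      rw [hr, ← Real.rpow_natCast, ← Real.rpow_mul hpos.le]
      norm_num
    rw [h3]
    field_simp
  have ht0 : t < 0 := by
    rw [ht]; exact div_neg_of_neg_of_pos (by norm_num) (by positivity)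
  have hct : c * t = -3 / 2 := by
    rw [ht]; field_simp
  have hft : a * t ^ 3 + c * t + 1 < 0 := by
    have h3 : c ^ 3 * t ^ 3 = -27 / 8 := by
      rw [← mul_pow, hct]; norm_num
    have ht3 : t ^ 3 < 0 := Odd.pow_neg (by decide) ht0
    have h4 := mul_lt_mul_of_neg_right h ht3
    rw [hct]
    nlinarith
  obtain ⟨q, hq⟩ : ∃ q : ℝ, q = (c + 1) / (-a) := ⟨_, rfl⟩
  have hq0 : 0 < q := by rw [hq]; exact div_pos (by linarith) (by linarith)
  have haq : -a * q = c + 1 := by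
    rw [hq]; field_simp
  obtain ⟨M, hM⟩ : ∃ M : ℝ, M = 1 + q + r - t := ⟨_, rfl⟩
  have hM1 : 1 < M := by linarith
  have hMr : r < M := by linarith
  have hMt : -M < t := by linarith
  have hMq : q ≤ M ^ 2 := by nlinarith
  have hM2 : c + 1 ≤ -a * M ^ 2 := by
    rw [← haq]; exact mul_le_mul_of_nonneg_left hMq (by linarith)
  have hM3 : (c + 1) * M ≤ -a * M ^ 2 * M :=
    mul_le_mul_of_nonneg_right hM2 (by linarith)
  have hcont : Continuous (fun x : ℝ => a * x ^ 3 + c * x + 1) := by fun_prop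
  obtain ⟨x₁, ⟨h1a, h1b⟩, h1⟩ := intermediate_value_Ioo' hMt.le hcont.continuousOn
    (show (0 : ℝ) ∈ Set.Ioo _ _ from ⟨hft, by nlinarith⟩)
  obtain ⟨x₂, ⟨h2a, h2b⟩, h2⟩ := intermediate_value_Ioo ht0.le hcont.continuousOn
    (show (0 : ℝ) ∈ Set.Ioo _ _ from ⟨hft, by norm_num⟩)
  obtain ⟨x₃, ⟨h3a, h3b⟩, h3⟩ := intermediate_value_Ioo' hMr.le hcont.continuousOn
    (show (0 : ℝ) ∈ Set.Ioo _ _ from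
      ⟨by nlinarith, by nlinarith [mul_pos hc hr0]⟩)
  dsimp only at h1 h2 h3
  have h12 : x₁ < x₂ := by linarith
  have h23 : x₂ < x₃ := by linarith
  have key : ∀ y : ℝ, a * y ^ 3 + c * y + 1 = 0 → y ≠ x₁ → y ≠ x₂ → y = -x₁ - x₂ := by
    intro y hy n1 n2
    have e1 : a * (y ^ 2 + y * x₁ + x₁ ^ 2) + c = 0 :=
      mul_left_cancel₀ (sub_ne_zero.2 n1) (by linear_combination hy - h1)
    have e2 : a * (x₂ ^ 2 + x₂ * x₁ + x₁ ^ 2) + c = 0 :=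
      mul_left_cancel₀ (sub_ne_zero.2 h12.ne') (by linear_combination h2 - h1)
    have e3 : y + x₁ + x₂ = 0 :=
      mul_left_cancel₀ (mul_ne_zero ha.ne (sub_ne_zero.2 n2)) (by linear_combination e1 - e2)
    linarith
  refine ⟨x₁, x₂, x₃, h12, h23, h1, h2, h3, ?_, h1b, h2a, h2b, h3a⟩
  intro y hy
  by_cases n1 : y = x₁
  · exact Or.inl n1
  by_cases n2 : y = x₂
  · exact Or.inr (Or.inl n2)
  right; right
  rw [key y hy n1 n2, key x₃ h3 (h12.trans h23).ne' h23.ne']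
end

section
/- Let b > 0 and c > 0 be real numbers and set a = b³/c³, so that −c/b is a root of the cubic p(x) = ax³ + bx² + cx + 1. Then: (i) if c² < 3b, then −c/b is the only real root of p; (ii) if c² > 3b, then p has exactly three real roots x₁ < x₂ < x₃, all negative, with x₁ < −c/b, x₂ = −c/b, and −c/b < x₃ < 0; (iii) if c² = 3b, then p has the triple root −3/c = −c/b. -/
/-- For `b > 0`, `c > 0` and `a = b³/c³` (so `−c/b` is a root of `p(x) = ax³ + bx² + cx + 1`):
(i) if `c² < 3b` then `−c/b` is the only real root; (ii) if `c² > 3b` then there are exactly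
three real roots `x₁ < x₂ = −c/b < x₃ < 0`, all negative; (iii) if `c² = 3b` then `p` has the
triple root `−3/c = −c/b`. -/
theorem stmt16 (b c : ℝ) (hb : 0 < b) (hc : 0 < c) (a : ℝ) (ha : a = b ^ 3 / c ^ 3) :
    (a * (-c / b) ^ 3 + b * (-c / b) ^ 2 + c * (-c / b) + 1 = 0) ∧
    (c ^ 2 < 3 * b →
      ∀ x : ℝ, a * x ^ 3 + b * x ^ 2 + c * x + 1 = 0 ↔ x = -c / b) ∧
    (c ^ 2 > 3 * b →
      ∃ x₁ x₃ : ℝ, x₁ < -c / b ∧ -c / b < x₃ ∧ x₃ < 0 ∧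
        a * x₁ ^ 3 + b * x₁ ^ 2 + c * x₁ + 1 = 0 ∧
        a * x₃ ^ 3 + b * x₃ ^ 2 + c * x₃ + 1 = 0 ∧
        ∀ y : ℝ, a * y ^ 3 + b * y ^ 2 + c * y + 1 = 0 → y = x₁ ∨ y = -c / b ∨ y = x₃) ∧
    (c ^ 2 = 3 * b →
      -3 / c = -c / b ∧ ∀ x : ℝ, a * x ^ 3 + b * x ^ 2 + c * x + 1 = a * (x + 3 / c) ^ 3) := by
  have key : ∀ t : ℝ, a * (c / b * t) ^ 3 + b * (c / b * t) ^ 2 + c * (c / b * t) + 1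
      = (t + 1) * (t ^ 2 + (c ^ 2 / b - 1) * t + 1) := by
    intro t
    rw [ha]
    field_simp
    ring
  have hr : 0 < c / b := div_pos hc hb
  have hsub : ∀ x : ℝ, ∃ t : ℝ, x = c / b * t := fun x => ⟨x / (c / b), by field_simp⟩
  have hneg : -c / b = c / b * (-1) := by ring
  have hk0 : 0 < c ^ 2 / b := by positivity
  have hroot : a * (-c / b) ^ 3 + b * (-c / b) ^ 2 + c * (-c / b) + 1 = 0 := by
    rw [hneg, key]; ring
  refine ⟨hroot, ?_, ?_, ?_⟩
  · intro h x
    refine ⟨fun hx => ?_, fun hx => by rw [hx]; exact hroot⟩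
    obtain ⟨t, rfl⟩ := hsub x
    have hk : c ^ 2 / b < 3 := by rw [div_lt_iff₀ hb]; exact h
    rw [key] at hx
    rcases mul_eq_zero.1 hx with h1 | h1
    · rw [hneg, show t = -1 by linarith]
    · exfalso
      generalize c ^ 2 / b = k at *
      nlinarith [sq_nonneg (2 * t + (k - 1)), mul_pos (sub_pos.2 hk) (show 0 < k + 1 by linarith)]
  · intro h
    have hk : 3 < c ^ 2 / b := by rw [lt_div_iff₀ hb]; exact h
    generalize c ^ 2 / b = k at *
    have hD : 0 < (k - 3) * (k + 1) := mul_pos (by linarith) (by linarith)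
    obtain ⟨s, hs, hs2⟩ : ∃ s : ℝ, 0 < s ∧ s ^ 2 = (k - 3) * (k + 1) :=
      ⟨√((k - 3) * (k + 1)), Real.sqrt_pos.2 hD, Real.sq_sqrt hD.le⟩
    have hs3 : s < k - 1 := by nlinarith
    have hs4 : k - 3 < s := by nlinarith
    refine ⟨c / b * ((-(k - 1) - s) / 2), c / b * ((-(k - 1) + s) / 2), ?_, ?_, ?_, ?_, ?_, ?_⟩
    · rw [hneg]; exact mul_lt_mul_of_pos_left (by linarith) hr
    · rw [hneg]; exact mul_lt_mul_of_pos_left (by linarith) hr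
    · exact mul_neg_of_pos_of_neg hr (by linarith)
    · rw [key]; apply mul_eq_zero_of_right; linear_combination hs2 / 4
    · rw [key]; apply mul_eq_zero_of_right; linear_combination hs2 / 4
    · intro y hy
      obtain ⟨t, rfl⟩ := hsub y
      rw [key] at hy
      rcases mul_eq_zero.1 hy with h1 | h1
      · right; left
        rw [hneg, show t = -1 by linarith]
      · have h2 : (t - (-(k - 1) - s) / 2) * (t - (-(k - 1) + s) / 2) = 0 := by
          linear_combination h1 - hs2 / 4
        rcases mul_eq_zero.1 h2 with h3 | h3
        · left; rw [sub_eq_zero.1 h3]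
        · right; right; rw [sub_eq_zero.1 h3]
  · intro h
    have hb' : b = c ^ 2 / 3 := by linarith
    subst hb'
    refine ⟨by field_simp, fun x => ?_⟩
    rw [ha]
    field_simp
    ring
end

section
/- Let a > 0, b < 0, and c > 0 be real numbers. Then the cubic equation ax³ + bx² + cx + 1 = 0 has exactly one negative real root x₀, and it satisfies −(1/a)^{1/3} < x₀ < 0. -/
/-- For `a > 0`, `b < 0`, `c > 0`, the cubic `ax³ + bx² + cx + 1 = 0` has exactly one negative
real root `x₀`, and `−(1/a)^{1/3} < x₀ < 0`. -/
theorem stmt17 (a b c : ℝ) (ha : 0 < a) (hb : b < 0) (hc : 0 < c) :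
    ∃ x₀ : ℝ, x₀ < 0 ∧ a * x₀ ^ 3 + b * x₀ ^ 2 + c * x₀ + 1 = 0 ∧
      -(1 / a) ^ ((1 : ℝ) / 3) < x₀ ∧
      ∀ y : ℝ, y < 0 → a * y ^ 3 + b * y ^ 2 + c * y + 1 = 0 → y = x₀ := by
  have htpos : 0 < (1 / a) ^ ((1 : ℝ) / 3) := by positivity
  have ht3 : ((1 / a) ^ ((1 : ℝ) / 3)) ^ 3 = 1 / a := by
    rw [← Real.rpow_natCast, ← Real.rpow_mul (by positivity)]
    norm_num
  generalize (1 / a) ^ ((1 : ℝ) / 3) = t at htpos ht3 ⊢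
  have hat : a * t ^ 3 = 1 := by rw [ht3]; field_simp
  have hcont : ContinuousOn (fun x : ℝ => a * x ^ 3 + b * x ^ 2 + c * x + 1)
      (Set.Icc (-t) 0) := by fun_prop
  have hneg : a * (-t) ^ 3 + b * (-t) ^ 2 + c * (-t) + 1 < 0 := by
    have h1 : b * t ^ 2 < 0 := mul_neg_of_neg_of_pos hb (by positivity)
    have h2 : 0 < c * t := by positivity
    have h3 : a * (-t) ^ 3 + b * (-t) ^ 2 + c * (-t) + 1
      = -(a * t ^ 3) + b * t ^ 2 - c * t + 1 := by ring
    rw [h3, hat]; linarith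
  obtain ⟨x, ⟨hx1, hx2⟩, hx⟩ := intermediate_value_Ioo (by linarith : -t ≤ 0) hcont
    (show (0 : ℝ) ∈ Set.Ioo _ _ from ⟨hneg, by norm_num⟩)
  refine ⟨x, hx2, hx, hx1, fun y hy hy0 => ?_⟩
  have hx' : a * x ^ 3 + b * x ^ 2 + c * x + 1 = 0 := hx
  have hprod : (y - x) * (a * (y ^ 2 + y * x + x ^ 2) + b * (y + x) + c) = 0 := by
    linear_combination hy0 - hx'
  have hpos : 0 < a * (y ^ 2 + y * x + x ^ 2) + b * (y + x) + c := by
    have h1 : 0 < y * x := mul_pos_of_neg_of_neg hy hx2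
    have h2 : 0 < b * (y + x) := mul_pos_of_neg_of_neg hb (by linarith)
    positivity
  rcases mul_eq_zero.mp hprod with h | h
  · linarith
  · exact absurd h hpos.ne'
end

section
/- Let a > 0, b > 0, and c < 0 be real numbers with c² ≤ 4b. Then the cubic equation ax³ + bx² + cx + 1 = 0 has exactly one real root x₀, and it satisfies x₀ < −(1/a)^{1/3}. -/
/-- For `a > 0`, `b > 0`, `c < 0` with `c² ≤ 4b`, the cubic `ax³ + bx² + cx + 1 = 0` has exactly
one real root `x₀`, and `x₀ < −(1/a)^{1/3}`. -/
theorem stmt18 (a b c : ℝ) (ha : 0 < a) (hb : 0 < b) (hc : c < 0) (h : c ^ 2 ≤ 4 * b) :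
    ∃ x₀ : ℝ, a * x₀ ^ 3 + b * x₀ ^ 2 + c * x₀ + 1 = 0 ∧
      x₀ < -(1 / a) ^ ((1 : ℝ) / 3) ∧
      ∀ y : ℝ, a * y ^ 3 + b * y ^ 2 + c * y + 1 = 0 → y = x₀ := by
  have hneg : ∀ y : ℝ, a * y ^ 3 + b * y ^ 2 + c * y + 1 = 0 → y < 0 := by
    intro y hy
    by_contra hy0
    push Not at hy0
    rcases hy0.eq_or_lt with h0 | h0
    · subst h0
      norm_num at hy
    · have h1 : 0 < a * y ^ 3 := by positivity
      have h2 : 0 ≤ 4 * b * (b * y ^ 2 + c * y + 1) := by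
        nlinarith [sq_nonneg (2 * b * y + c)]
      have h3 : 0 ≤ b * y ^ 2 + c * y + 1 := nonneg_of_mul_nonneg_right h2 (by positivity)
      linarith
  obtain ⟨x, hx⟩ : ∃ x : ℝ, a * x ^ 3 + b * x ^ 2 + c * x + 1 = 0 := by
    obtain ⟨M, hM⟩ : ∃ M : ℝ, M = 1 + (b - c + 1) / a := ⟨_, rfl⟩
    have hq : 0 < (b - c + 1) / a := div_pos (by linarith) ha
    have hM1 : 1 ≤ M := by linarith
    have haM : a * M = a + (b - c + 1) := by rw [hM]; field_simp
    have hlow : a * (-M) ^ 3 + b * (-M) ^ 2 + c * (-M) + 1 ≤ 0 := by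
      have e : a * (-M) ^ 3 + b * (-M) ^ 2 + c * (-M) + 1
          = -(a * M ^ 2) + c * (M ^ 2 - M) + (1 - M ^ 2) := by
        linear_combination (-M ^ 2) * haM
      have h1 : 0 ≤ M ^ 2 - M := by nlinarith
      have h2 : 0 ≤ a * M ^ 2 := by positivity
      have h3 : c * (M ^ 2 - M) ≤ 0 := mul_nonpos_of_nonpos_of_nonneg hc.le h1
      rw [e]; linarith
    have hcont : ContinuousOn (fun x : ℝ => a * x ^ 3 + b * x ^ 2 + c * x + 1)
        (Set.Icc (-M) 0) := by fun_prop
    obtain ⟨x, -, hx⟩ := intermediate_value_Icc (by linarith : -M ≤ 0) hcont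
      (show (0 : ℝ) ∈ Set.Icc _ _ from ⟨hlow, by norm_num⟩)
    exact ⟨x, hx⟩
  have hx0 := hneg x hx
  refine ⟨x, hx, ?_, ?_⟩
  · have hcx : 0 < c * x := mul_pos_of_neg_of_neg hc hx0
    have hbx : 0 < b * x ^ 2 := mul_pos hb (by nlinarith)
    have h1 : 1 / a < (-x) ^ 3 := by
      rw [div_lt_iff₀ ha]; nlinarith
    have h2 : (1 / a) ^ ((1 : ℝ) / 3) < ((-x) ^ 3) ^ ((1 : ℝ) / 3) :=
      Real.rpow_lt_rpow (by positivity) h1 (by norm_num)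
    have h3 : ((-x) ^ 3) ^ ((1 : ℝ) / 3) = -x := by
      rw [← Real.rpow_natCast, ← Real.rpow_mul (by linarith)]
      norm_num
    linarith
  · intro y hy
    have hy0 := hneg y hy
    have hxy : 0 < x * y := mul_pos_of_neg_of_neg hx0 hy0
    have hs : 0 < c * (x + y) := mul_pos_of_neg_of_neg hc (by linarith)
    have hf : (y - x) * (b * (x * y) ^ 2 + c * (x + y) * (x * y) + (x ^ 2 + x * y + y ^ 2)) = 0 := by
      linear_combination y ^ 3 * hx - x ^ 3 * hy
    have hpos : 0 < b * (x * y) ^ 2 + c * (x + y) * (x * y) + (x ^ 2 + x * y + y ^ 2) := by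
      positivity
    rcases mul_eq_zero.mp hf with h1 | h1
    · linarith
    · exact absurd h1 hpos.ne'
end

section
/- Let a > 0, b > 0, and c < 0 be real numbers with c² > 4b, and suppose 0 < a < α₁ where α₁ = −(2/27)c³ + (1/3)bc + (2/27)(c² − 3b)^{3/2}. Set χ = (−c − √(c² − 3b))/b, σ₁ = (−c + √(c² − 4b))/(2b), and σ₂ = (−c − √(c² − 4b))/(2b). Then the cubic equation ax³ + bx² + cx + 1 = 0 has exactly three real roots x₁ < x₂ < x₃, and they satisfy x₁ < −(1/a)^{1/3} < 0, σ₂ < x₂ < χ, and χ < x₃ < σ₁. -/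
set_option maxHeartbeats 1000000 in
/-- For `a > 0`, `b > 0`, `c < 0` with `c² > 4b` and `0 < a < α₁`, where
`α₁ = −(2/27)c³ + (1/3)bc + (2/27)(c² − 3b)^{3/2}`, setting `χ = (−c − √(c² − 3b))/b`,
`σ₁ = (−c + √(c² − 4b))/(2b)`, `σ₂ = (−c − √(c² − 4b))/(2b)`, the cubic
`ax³ + bx² + cx + 1 = 0` has exactly three real roots `x₁ < x₂ < x₃`, with
`x₁ < −(1/a)^{1/3} < 0`, `σ₂ < x₂ < χ` and `χ < x₃ < σ₁`. -/
theorem stmt19 (a b c : ℝ) (ha : 0 < a) (hb : 0 < b) (hc : c < 0) (h4 : c ^ 2 > 4 * b)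
    (hα : a < -(2 / 27) * c ^ 3 + (1 / 3) * b * c + (2 / 27) * Real.sqrt (c ^ 2 - 3 * b) ^ 3)
    (χ σ₁ σ₂ : ℝ)
    (hχ : χ = (-c - Real.sqrt (c ^ 2 - 3 * b)) / b)
    (hσ₁ : σ₁ = (-c + Real.sqrt (c ^ 2 - 4 * b)) / (2 * b))
    (hσ₂ : σ₂ = (-c - Real.sqrt (c ^ 2 - 4 * b)) / (2 * b)) :
    ∃ x₁ x₂ x₃ : ℝ, x₁ < x₂ ∧ x₂ < x₃ ∧
      a * x₁ ^ 3 + b * x₁ ^ 2 + c * x₁ + 1 = 0 ∧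
      a * x₂ ^ 3 + b * x₂ ^ 2 + c * x₂ + 1 = 0 ∧
      a * x₃ ^ 3 + b * x₃ ^ 2 + c * x₃ + 1 = 0 ∧
      (∀ y : ℝ, a * y ^ 3 + b * y ^ 2 + c * y + 1 = 0 → y = x₁ ∨ y = x₂ ∨ y = x₃) ∧
      x₁ < -(1 / a) ^ ((1 : ℝ) / 3) ∧ -(1 / a) ^ ((1 : ℝ) / 3) < 0 ∧
      σ₂ < x₂ ∧ x₂ < χ ∧ χ < x₃ ∧ x₃ < σ₁ := by
  have hs0 : 0 < c ^ 2 - 3 * b := by linarith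
  have hr0 : 0 < c ^ 2 - 4 * b := by linarith
  have hs := Real.sqrt_pos.mpr hs0
  have hr := Real.sqrt_pos.mpr hr0
  have hs2 := Real.sq_sqrt hs0.le
  have hr2 := Real.sq_sqrt hr0.le
  set s := Real.sqrt (c ^ 2 - 3 * b) with hsdef
  set r := Real.sqrt (c ^ 2 - 4 * b) with hrdef
  clear_value s r
  have hbs : b = (c ^ 2 - s ^ 2) / 3 := by linarith
  have hus : s < -c := by nlinarith
  have hu2 : -c < 2 * s := by nlinarith
  have hru : r < -c := by nlinarith
  have hD : 0 < s - c := by linarith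
  have hχ' : χ = 3 / (s - c) := by
    rw [hχ, div_eq_div_iff hb.ne' hD.ne']
    linarith [hs2]
  have hχD : χ * (s - c) = 3 := by rw [hχ']; field_simp
  have hχ0 : 0 < χ := by rw [hχ']; positivity
  have hσ₂0 : 0 < σ₂ := by rw [hσ₂]; apply div_pos <;> linarith
  have hσlt : σ₂ < σ₁ := by
    rw [hσ₁, hσ₂]
    apply div_lt_div_of_pos_right _ (by linarith)
    linarith
  have hsum : b * (σ₁ + σ₂) = -c := by rw [hσ₁, hσ₂]; field_simp; ring
  have hprod : b * (σ₁ * σ₂) = 1 := by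
    rw [hσ₁, hσ₂]; field_simp; linarith [hr2]
  have hfac : ∀ x : ℝ, b * x ^ 2 + c * x + 1 = b * ((x - σ₁) * (x - σ₂)) := by
    intro x
    linear_combination (x) * hsum - hprod
  -- double root quadratic at χ
  have hdr : b * χ ^ 2 + 2 * c * χ + 3 = 0 := by
    rw [hbs, hχ']; field_simp; ring
  have hneg : b * χ ^ 2 + c * χ + 1 < 0 := by
    have : b * χ ^ 2 + c * χ + 1 = (-c - 2 * s) / (s - c) := by
      rw [hbs, hχ']; field_simp; ring
    rw [this]
    exact div_neg_of_neg_of_pos (by linarith) hD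
  have hbet : (χ - σ₁) * (χ - σ₂) < 0 := by
    rw [hfac] at hneg
    exact (pos_iff_neg_of_mul_neg hneg).mp hb
  have h1 : σ₂ < χ := by
    by_contra h
    linarith [mul_nonneg (sub_nonneg.mpr (not_lt.mp h)) (by linarith : 0 ≤ σ₁ - χ)]
  have h2 : χ < σ₁ := by
    by_contra h
    linarith [mul_nonneg (sub_nonneg.mpr (not_lt.mp h)) (by linarith : 0 ≤ χ - σ₂)]
  have hpχ : a * χ ^ 3 + b * χ ^ 2 + c * χ + 1 < 0 := by
    have hα2 : (-(2 / 27) * c ^ 3 + (1 / 3) * b * c + (2 / 27) * s ^ 3) * χ ^ 3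
        + b * χ ^ 2 + c * χ + 1 = 0 := by
      rw [hbs, hχ']; field_simp; ring
    have := mul_lt_mul_of_pos_right hα (pow_pos hχ0 3)
    linarith
  have hpσ₁ : 0 < a * σ₁ ^ 3 + b * σ₁ ^ 2 + c * σ₁ + 1 := by
    have := hfac σ₁
    have h3 : 0 < a * σ₁ ^ 3 := mul_pos ha (pow_pos (by linarith) 3)
    simp only [sub_self, zero_mul, mul_zero] at this
    linarith
  have hpσ₂ : 0 < a * σ₂ ^ 3 + b * σ₂ ^ 2 + c * σ₂ + 1 := by
    have := hfac σ₂
    have h3 : 0 < a * σ₂ ^ 3 := mul_pos ha (pow_pos (by linarith) 3)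
    simp only [sub_self, mul_zero] at this
    linarith
  have ht : 0 < (1 / a) ^ ((1 : ℝ) / 3) := Real.rpow_pos_of_pos (by positivity) _
  have ht3 : a * ((1 / a) ^ ((1 : ℝ) / 3)) ^ 3 = 1 := by
    rw [← Real.rpow_natCast, ← Real.rpow_mul (by positivity)]
    norm_num
    field_simp
  set t := (1 / a) ^ ((1 : ℝ) / 3) with htdef
  clear_value t
  have hpt : 0 < a * (-t) ^ 3 + b * (-t) ^ 2 + c * (-t) + 1 := by
    have e1 : 0 < b * t ^ 2 := by positivity
    have e2 : 0 < (-c) * t := mul_pos (by linarith) ht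
    linarith
  obtain ⟨M, hM1, hMt, hMa⟩ : ∃ M : ℝ, 1 ≤ M ∧ t < M ∧ b - c + 1 < a * M := by
    refine ⟨1 + t + (b - c + 1) / a, ?_, ?_, ?_⟩
    · have : 0 < (b - c + 1) / a := div_pos (by linarith) ha
      linarith
    · have : 0 < (b - c + 1) / a := div_pos (by linarith) ha
      linarith
    · have : a * (1 + t + (b - c + 1) / a) = a + a * t + (b - c + 1) := by field_simp
      have := mul_pos ha ht
      linarith
  have hpM : a * (-M) ^ 3 + b * (-M) ^ 2 + c * (-M) + 1 < 0 := by
    have e1 : (b - c + 1) * M ^ 2 < a * M * M ^ 2 :=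
      mul_lt_mul_of_pos_right hMa (by positivity)
    have e2 : M ≤ M ^ 2 := by nlinarith
    have e3 : (-c) * M ≤ (-c) * M ^ 2 := mul_le_mul_of_nonneg_left e2 (by linarith)
    have e4 : 1 ≤ M ^ 2 := by linarith
    linarith
  have hcont : Continuous (fun x : ℝ => a * x ^ 3 + b * x ^ 2 + c * x + 1) := by fun_prop
  obtain ⟨x₁, ⟨_, hx₁⟩, hp₁⟩ :=
    intermediate_value_Ioo (by linarith : -M ≤ -t) hcont.continuousOn ⟨hpM, hpt⟩
  obtain ⟨x₂, ⟨hx₂, hx₂'⟩, hp₂⟩ :=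
    intermediate_value_Ioo' h1.le hcont.continuousOn ⟨hpχ, hpσ₂⟩
  obtain ⟨x₃, ⟨hx₃, hx₃'⟩, hp₃⟩ :=
    intermediate_value_Ioo h2.le hcont.continuousOn ⟨hpχ, hpσ₁⟩
  simp only at hp₁ hp₂ hp₃
  have h12 : x₁ < x₂ := by linarith
  have h23 : x₂ < x₃ := by linarith
  refine ⟨x₁, x₂, x₃, h12, h23, hp₁, hp₂, hp₃, ?_, hx₁, by linarith, hx₂, hx₂', hx₃, hx₃'⟩
  intro y hy
  have key : ∀ z : ℝ, a * z ^ 3 + b * z ^ 2 + c * z + 1 = 0 → z ≠ x₁ → z ≠ x₂ →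
      a * (z + x₁ + x₂) + b = 0 := by
    intro z hz n1 n2
    have k1 : a * (z ^ 2 + z * x₁ + x₁ ^ 2) + b * (z + x₁) + c = 0 := by
      apply mul_left_cancel₀ (sub_ne_zero.mpr n1)
      linear_combination hz - hp₁
    have k2 : a * (x₂ ^ 2 + x₂ * x₁ + x₁ ^ 2) + b * (x₂ + x₁) + c = 0 := by
      apply mul_left_cancel₀ (sub_ne_zero.mpr h12.ne')
      linear_combination hp₂ - hp₁
    apply mul_left_cancel₀ (sub_ne_zero.mpr n2)
    linear_combination k1 - k2
  by_cases n1 : y = x₁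
  · exact Or.inl n1
  by_cases n2 : y = x₂
  · exact Or.inr (Or.inl n2)
  have k := key y hy n1 n2
  have k' := key x₃ hp₃ (by linarith : x₁ < x₃).ne' h23.ne'
  right; right
  apply mul_left_cancel₀ ha.ne'
  linear_combination k - k'
end
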